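/- Let c : ℝ → ℝ be convex, monotone increasing, and twice differentiable with c″/c′ monotone non-increasing. Fix θ ∈ ℝ^d and convex sets F₊, F₋ ⊆ ℝ^d. Define G̃ = {α c′(−y ⟨θ, x⟩)(−y x) : 0 ≤ α ≤ 1, y ∈ {−1, +1}, x ∈ F_y}. Then the Carathéodory number of G̃ is at most 2: every point of conv(G̃) is a convex combination of at most 2 points of G̃. -/

import Mathlib

open scoped RealInnerProductSpace

theorem aux_pos (c c' : ℝ → ℝ) (hconv : ConvexOn ℝ Set.univ c) (hmono : StrictMono c)
    (hd1 : ∀ v, HasDerivAt c (c' v) v) (v : ℝ) : 0 < c' v := by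
  have h1 : slope c (v - 1) v ≤ c' v :=
    hconv.slope_le_of_hasDerivAt (Set.mem_univ _) (Set.mem_univ _) (by linarith) (hd1 v)
  have h2 : 0 < slope c (v - 1) v := by
    rw [slope_def_field]
    have : c (v - 1) < c v := hmono (by linarith)
    apply div_pos <;> linarith
  linarith

theorem aux_mono (c c' : ℝ → ℝ) (hconv : ConvexOn ℝ Set.univ c)
    (hd1 : ∀ v, HasDerivAt c (c' v) v) : Monotone c' := by
  intro a b hab
  rcases hab.eq_or_lt with rfl | hab
  · exact le_rfl
  · exact (hconv.le_slope_of_hasDerivAt (Set.mem_univ _) (Set.mem_univ _) hab (hd1 a)).trans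
      (hconv.slope_le_of_hasDerivAt (Set.mem_univ _) (Set.mem_univ _) hab (hd1 b))

theorem aux_inv (c' c'' : ℝ → ℝ) (hpos : ∀ v, 0 < c' v) (hm : Monotone c')
    (hd2 : ∀ v, HasDerivAt c' (c'' v) v)
    (hratio : Antitone fun v => c'' v / c' v) : ConvexOn ℝ Set.univ (fun v => (c' v)⁻¹) := by
  have hd : ∀ v, HasDerivAt (fun v => (c' v)⁻¹) (-(c'' v) / (c' v) ^ 2) v :=
    fun v => (hd2 v).fun_inv (hpos v).ne'
  have hnn : ∀ v, 0 ≤ c'' v := fun v => by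
    rw [← (hd2 v).deriv]; exact hm.deriv_nonneg
  apply Monotone.convexOn_univ_of_deriv (fun v => (hd v).differentiableAt)
  intro a b hab
  rw [(hd a).deriv, (hd b).deriv]
  have e : ∀ v, -(c'' v) / (c' v) ^ 2 = -((c'' v / c' v) * (c' v)⁻¹) := fun v => by
    have := (hpos v).ne'
    field_simp
  rw [e, e, neg_le_neg_iff]
  exact mul_le_mul (hratio hab) (inv_anti₀ (hpos a) (hm hab)) (inv_nonneg.2 (hpos b).le)
    (div_nonneg (hnn a) (hpos a).le)

theorem aux_convex {E : Type*} [NormedAddCommGroup E] [InnerProductSpace ℝ E] (f : ℝ → ℝ)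
    (hpos : ∀ v, 0 < f v) (hf : ConvexOn ℝ Set.univ (fun v => (f v)⁻¹)) (θ : E) (K : Set E)
    (hK : Convex ℝ K) :
    Convex ℝ {g : E | ∃ (α : ℝ) (u : E), 0 ≤ α ∧ α ≤ 1 ∧ u ∈ K ∧ g = (α * f ⟪θ, u⟫) • u} := by
  rintro _ ⟨α, u, h0, h1, hu, rfl⟩ _ ⟨β, w, k0, k1, hw, rfl⟩ a b ha hb hab
  set s := f ⟪θ, u⟫ with hs
  set t := f ⟪θ, w⟫ with ht
  have hsp : 0 < s := hpos _
  have htp : 0 < t := hpos _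
  have n1 : 0 ≤ a * α * s := by positivity
  have n2 : 0 ≤ b * β * t := by positivity
  have hle : a * α + b * β ≤ 1 := by nlinarith
  rcases (add_nonneg n1 n2).eq_or_lt with h | hS
  · have e1 : a * α * s = 0 := by linarith
    have e2 : b * β * t = 0 := by linarith
    refine ⟨0, u, le_rfl, zero_le_one, hu, ?_⟩
    rw [smul_smul, smul_smul, ← mul_assoc, ← mul_assoc, e1, e2]
    simp
  · set S := a * α * s + b * β * t with hSd
    have p1 : 0 ≤ a * α * s / S := by positivity
    have p2 : 0 ≤ b * β * t / S := by positivity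
    have p3 : a * α * s / S + b * β * t / S = 1 := by rw [← add_div]; exact div_self hS.ne'
    set x := (a * α * s / S) • u + (b * β * t / S) • w with hx
    have hxK : x ∈ K := hK hu hw p1 p2 p3
    have hc := hf.2 (Set.mem_univ ⟪θ, u⟫) (Set.mem_univ ⟪θ, w⟫) p1 p2 p3
    have hin : ⟪θ, x⟫ = (a * α * s / S) • ⟪θ, u⟫ + (b * β * t / S) • ⟪θ, w⟫ := by
      rw [hx, inner_add_right, real_inner_smul_right, real_inner_smul_right]; rfl
    simp only [← hin, ← hs, ← ht] at hc
    have hc2 : (f ⟪θ, x⟫)⁻¹ ≤ S⁻¹ := by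
      refine hc.trans ?_
      have : (a * α * s / S) • s⁻¹ + (b * β * t / S) • t⁻¹ = (a * α + b * β) * S⁻¹ := by
        simp only [smul_eq_mul]; field_simp
      rw [this]
      exact mul_le_of_le_one_left (inv_nonneg.2 hS.le) hle
    have hc3 : S ≤ f ⟪θ, x⟫ := (inv_le_inv₀ (hpos _) hS).1 hc2
    have hxp := hpos ⟪θ, x⟫
    refine ⟨S / f ⟪θ, x⟫, x, by positivity, (div_le_one hxp).2 hc3, hxK, ?_⟩
    rw [div_mul_cancel₀ _ hxp.ne', hx, smul_add, smul_smul, smul_smul, smul_smul, smul_smul,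
      mul_div_cancel₀ _ hS.ne', mul_div_cancel₀ _ hS.ne', ← mul_assoc, ← mul_assoc]

theorem aux_join {E : Type*} [AddCommGroup E] [Module ℝ E] (A B : Set E) (hA : Convex ℝ A)
    (hB : Convex ℝ B) (v : E) (hv : v ∈ convexHull ℝ (A ∪ B)) :
    ∃ (p : Fin 2 → E) (w : Fin 2 → ℝ), (∀ i, p i ∈ A ∪ B) ∧
      (∀ i, 0 ≤ w i) ∧ (∑ i, w i) = 1 ∧ v = ∑ i, w i • p i := by
  have triv : v ∈ A ∪ B → ∃ (p : Fin 2 → E) (w : Fin 2 → ℝ), (∀ i, p i ∈ A ∪ B) ∧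
      (∀ i, 0 ≤ w i) ∧ (∑ i, w i) = 1 ∧ v = ∑ i, w i • p i := fun h =>
    ⟨fun _ => v, ![1, 0], fun _ => h, by simp [Fin.forall_fin_two], by simp, by simp⟩
  rcases A.eq_empty_or_nonempty with rfl | hAn
  · apply triv
    simpa [hB.convexHull_eq] using hv
  rcases B.eq_empty_or_nonempty with rfl | hBn
  · apply triv
    simpa [hA.convexHull_eq] using hv
  rw [convexHull_union hAn hBn, hA.convexHull_eq, hB.convexHull_eq, mem_convexJoin] at hv
  obtain ⟨x, hx, y, hy, a, b, ha, hb, hab, rfl⟩ := hv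
  exact ⟨![x, y], ![a, b], by simp [Fin.forall_fin_two, hx, hy],
    by simp [Fin.forall_fin_two, ha, hb], by simpa using hab, by simp⟩

/-- For a margin-based loss `ℓ(θ; x, y) = c(−y⟨θ,x⟩)` with `c` convex, monotone
increasing, twice differentiable, and `c''/c'` monotone non-increasing, and convex
per-class feasible slices `F₊, F₋`, the set of scaled gradients
`G̃ = {α c'(−y⟨θ,x⟩)(−y x) : 0 ≤ α ≤ 1, y ∈ {−1,+1}, x ∈ F_y}` has Carathéodory
number at most `2`: every point of `conv(G̃)` is a convex combination of at most `2`
points of `G̃`. -/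
theorem margin_scaled_gradients_carNumber_le_two
    {d : ℕ} (c c' c'' : ℝ → ℝ)
    (hconv : ConvexOn ℝ Set.univ c)
    (hmono : StrictMono c)
    (hd1 : ∀ v, HasDerivAt c (c' v) v)
    (hd2 : ∀ v, HasDerivAt c' (c'' v) v)
    (hratio : Antitone fun v => c'' v / c' v)
    (θ : EuclideanSpace ℝ (Fin d))
    (Fp Fm : Set (EuclideanSpace ℝ (Fin d)))
    (hFp : Convex ℝ Fp) (hFm : Convex ℝ Fm) :
    ∀ v ∈ convexHull ℝ {g : EuclideanSpace ℝ (Fin d) |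
        ∃ (α y : ℝ) (x : EuclideanSpace ℝ (Fin d)), 0 ≤ α ∧ α ≤ 1 ∧
          ((y = 1 ∧ x ∈ Fp) ∨ (y = -1 ∧ x ∈ Fm)) ∧
          g = (α * c' (-(y * ⟪θ, x⟫))) • ((-y) • x)},
      ∃ (p : Fin 2 → EuclideanSpace ℝ (Fin d)) (w : Fin 2 → ℝ),
        (∀ i, p i ∈ {g : EuclideanSpace ℝ (Fin d) |
            ∃ (α y : ℝ) (x : EuclideanSpace ℝ (Fin d)), 0 ≤ α ∧ α ≤ 1 ∧
              ((y = 1 ∧ x ∈ Fp) ∨ (y = -1 ∧ x ∈ Fm)) ∧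
              g = (α * c' (-(y * ⟪θ, x⟫))) • ((-y) • x)}) ∧
        (∀ i, 0 ≤ w i) ∧ (∑ i, w i) = 1 ∧ v = ∑ i, w i • p i := by
  have hpos := aux_pos c c' hconv hmono hd1
  have hinv := aux_inv c' c'' hpos (aux_mono c c' hconv hd1) hd2 hratio
  have hA := aux_convex c' hpos hinv θ (-Fp) hFp.neg
  have hB := aux_convex c' hpos hinv θ Fm hFm
  have key : {g : EuclideanSpace ℝ (Fin d) |
        ∃ (α y : ℝ) (x : EuclideanSpace ℝ (Fin d)), 0 ≤ α ∧ α ≤ 1 ∧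
          ((y = 1 ∧ x ∈ Fp) ∨ (y = -1 ∧ x ∈ Fm)) ∧
          g = (α * c' (-(y * ⟪θ, x⟫))) • ((-y) • x)} =
      {g | ∃ (α : ℝ) (u : EuclideanSpace ℝ (Fin d)), 0 ≤ α ∧ α ≤ 1 ∧ u ∈ -Fp ∧
        g = (α * c' ⟪θ, u⟫) • u} ∪
      {g | ∃ (α : ℝ) (u : EuclideanSpace ℝ (Fin d)), 0 ≤ α ∧ α ≤ 1 ∧ u ∈ Fm ∧
        g = (α * c' ⟪θ, u⟫) • u} := by
    ext g
    constructor
    · rintro ⟨α, y, x, h0, h1, ⟨rfl, hx⟩ | ⟨rfl, hx⟩, rfl⟩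
      · exact Or.inl ⟨α, -x, h0, h1, by simpa using hx, by simp [inner_neg_right]⟩
      · exact Or.inr ⟨α, x, h0, h1, hx, by simp⟩
    · rintro (⟨α, x, h0, h1, hx, rfl⟩ | ⟨α, x, h0, h1, hx, rfl⟩)
      · exact ⟨α, 1, -x, h0, h1, Or.inl ⟨rfl, hx⟩, by simp [inner_neg_right]⟩
      · exact ⟨α, -1, x, h0, h1, Or.inr ⟨rfl, hx⟩, by simp⟩
  rw [key]
  exact fun v hv => aux_join _ _ hA hB v hv
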